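/- Strict stability of the radial profile for small b: Assume a², b², c² > 0 with b⁴ ≤ 3a²c², let k ∈ ℤ \ {0} and R ∈ (0,∞]. Let (u,v) be a profile solution on (0,R) with u > 0 and v < 0 on (0,R). Then for every pair (ξ,η) of continuously differentiable real-valued functions with compact support contained in (0,R), not both identically zero, the second variation satisfies B(ξ,η) > 0. -/

import Mathlib

open Real MeasureTheory Filter Set Topology
open scoped ENNReal

noncomputable section

/-- `s₊ = (b² + √(b⁴ + 24 a² c²)) / (4c²)`, where `a2 = a²`, `b2 = b²`, `c2 = c²`. -/
def sPlus (a2 b2 c2 : ℝ) : ℝ := (b2 + Real.sqrt (b2 ^ 2 + 24 * a2 * c2)) / (4 * c2)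

/-- `h(p,q) = p(−a² + (2b²/√6)q + c²(p² + q²))`. -/
def hfun (a2 b2 c2 p q : ℝ) : ℝ :=
  p * (-a2 + 2 * b2 / Real.sqrt 6 * q + c2 * (p ^ 2 + q ^ 2))

/-- `g(p,q) = q(−a² − (b²/√6)q + c²(p² + q²)) + (b²/√6)p²`. -/
def gfun (a2 b2 c2 p q : ℝ) : ℝ :=
  q * (-a2 - b2 / Real.sqrt 6 * q + c2 * (p ^ 2 + q ^ 2)) + b2 / Real.sqrt 6 * p ^ 2

/-- The interval `(0, R)` for `R ∈ (0,∞]`, as a subset of `ℝ`. -/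
def Iset (R : ℝ≥0∞) : Set ℝ := {r : ℝ | 0 < r ∧ ENNReal.ofReal r < R}

/-- The filter of left-approach to the right endpoint `R`; `atTop` when `R = ∞`. -/
def endFilter (R : ℝ≥0∞) : Filter ℝ :=
  if R = ⊤ then Filter.atTop else nhdsWithin R.toReal (Set.Iio R.toReal)

/-- A profile solution on `(0,R)`: a C² pair `(u,v)` solving the radial ODE system with the
natural boundary conditions at `0` and at `R`. -/
structure ProfileSolution (a2 b2 c2 : ℝ) (k : ℤ) (R : ℝ≥0∞) (u v : ℝ → ℝ) : Prop where
  smooth_u : ContDiffOn ℝ 2 u (Iset R)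
  smooth_v : ContDiffOn ℝ 2 v (Iset R)
  ode_u : ∀ r ∈ Iset R,
    deriv (deriv u) r + deriv u r / r - (k : ℝ) ^ 2 / r ^ 2 * u r
      = hfun a2 b2 c2 (u r) (v r)
  ode_v : ∀ r ∈ Iset R,
    deriv (deriv v) r + deriv v r / r = gfun a2 b2 c2 (u r) (v r)
  bc0_u : Filter.Tendsto u (nhdsWithin 0 (Set.Ioi 0)) (nhds 0)
  bc0_v : Filter.Tendsto (deriv v) (nhdsWithin 0 (Set.Ioi 0)) (nhds 0)
  bcR_u : Filter.Tendsto u (endFilter R) (nhds (sPlus a2 b2 c2 / Real.sqrt 2))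
  bcR_v : Filter.Tendsto v (endFilter R) (nhds (-(sPlus a2 b2 c2 / Real.sqrt 6)))

/-- The second variation `B(ξ,η)` of the profile energy at `(u,v)`. -/
def Bform (a2 b2 c2 : ℝ) (k : ℤ) (R : ℝ≥0∞) (u v ξ η : ℝ → ℝ) : ℝ :=
  ∫ r in Iset R,
    (deriv ξ r ^ 2 + (k : ℝ) ^ 2 / r ^ 2 * ξ r ^ 2 + deriv η r ^ 2
      + (-a2 + 2 * b2 / Real.sqrt 6 * v r + c2 * (3 * u r ^ 2 + v r ^ 2)) * ξ r ^ 2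
      + (-a2 - 2 * b2 / Real.sqrt 6 * v r + c2 * (u r ^ 2 + 3 * v r ^ 2)) * η r ^ 2
      + 4 * u r * ξ r * η r * (b2 / Real.sqrt 6 + c2 * v r)) * r

theorem isOpen_Iset (R : ℝ≥0∞) : IsOpen (Iset R) :=
  (isOpen_lt continuous_const continuous_id).inter
    (isOpen_lt ENNReal.continuous_ofReal continuous_const)

theorem Icc_subset_Iset {R : ℝ≥0∞} {x y : ℝ} (hx : x ∈ Iset R) (hy : y ∈ Iset R) :
    Icc x y ⊆ Iset R := fun _ hz =>
  ⟨hx.1.trans_le hz.1, (ENNReal.ofReal_le_ofReal hz.2).trans_lt hy.2⟩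

theorem mem_Iset_of_le {R : ℝ≥0∞} {x y : ℝ} (hx : 0 < x) (hxy : x ≤ y) (hy : y ∈ Iset R) :
    x ∈ Iset R :=
  ⟨hx, (ENNReal.ofReal_le_ofReal hxy).trans_lt hy.2⟩

theorem eventually_endFilter {R : ℝ≥0∞} {x : ℝ} (hx : x ∈ Iset R) :
    ∀ᶠ y in endFilter R, x < y ∧ y ∈ Iset R := by
  unfold endFilter
  split_ifs with h
  · filter_upwards [eventually_gt_atTop x] with y hy
    exact ⟨hy, hx.1.trans hy, by simp [h]⟩
  · have hxR : x < R.toReal := (ENNReal.ofReal_lt_iff_lt_toReal hx.1.le h).1 hx.2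
    filter_upwards [Ioo_mem_nhdsLT hxR] with y hy
    exact ⟨hy.1, hx.1.trans hy.1,
      (ENNReal.ofReal_lt_iff_lt_toReal (hx.1.trans hy.1).le h).2 hy.2⟩

theorem endFilter_neBot {R : ℝ≥0∞} : (endFilter R).NeBot := by
  unfold endFilter
  split_ifs <;> infer_instance

/-- For `b⁴ ≤ 3a²c²`, the boundary value of `v` at `R` is at most `-b²/(√6 c²)`. -/
theorem neg_sPlus_div_le {a2 b2 c2 : ℝ} (hc : 0 < c2)
    (hle : b2 ^ 2 ≤ 3 * a2 * c2) : -(sPlus a2 b2 c2 / √6) ≤ -(b2 / √6 / c2) := by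
  have h3 : 3 * b2 ≤ √(b2 ^ 2 + 24 * a2 * c2) := Real.le_sqrt_of_sq_le (by nlinarith)
  have hs : b2 / c2 ≤ sPlus a2 b2 c2 := by
    unfold sPlus
    rw [div_le_div_iff₀ hc (by positivity)]
    nlinarith
  have : b2 / c2 / √6 ≤ sPlus a2 b2 c2 / √6 := by gcongr
  rw [div_right_comm]
  linarith

/-- For `b⁴ ≤ 3a²c²`, the function `g(p,·)` is positive on `(-b²/(√6 c²), 0)`. -/
theorem gfun_pos {a2 b2 c2 p q : ℝ} (hc : 0 < c2) (hle : b2 ^ 2 ≤ 3 * a2 * c2)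
    (hq : -(b2 / √6 / c2) < q) (hq0 : q < 0) : 0 < gfun a2 b2 c2 p q := by
  unfold gfun
  have hβ : 6 * (b2 / √6) ^ 2 = b2 ^ 2 := by
    rw [div_pow, Real.sq_sqrt (by norm_num)]; ring
  generalize b2 / √6 = β at *
  have h1 : -q * c2 < β := by
    rw [← lt_div_iff₀ hc]; linarith
  have h2 : 0 < -q * c2 := by nlinarith
  have h4 : 0 < a2 + β * q - c2 * q ^ 2 := by
    have : 0 < c2 * (a2 + β * q - c2 * q ^ 2) := by nlinarith
    exact pos_of_mul_pos_right this hc.le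
  nlinarith [mul_pos (neg_pos.2 hq0) h4, mul_nonneg (sq_nonneg p) (by linarith : 0 ≤ β + c2 * q)]

theorem eventually_right_lt_of_deriv_nonneg {v : ℝ → ℝ} {x d : ℝ} {s : Set ℝ} (hs : IsOpen s)
    (hxs : x ∈ s) (hx : 0 < x) (hv : DifferentiableOn ℝ v s) (hd : 0 ≤ deriv v x)
    (hF : HasDerivAt (fun r => r * deriv v r) d x) (hd0 : 0 < d) :
    ∀ᶠ y in 𝓝[>] x, v x < v y := by
  have hslope := (hasDerivAt_iff_tendsto_slope.1 hF).eventually (lt_mem_nhds hd0)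
  have h1 : ∀ᶠ y in 𝓝[>] x, 0 < slope (fun r => r * deriv v r) x y :=
    hslope.filter_mono (nhdsWithin_mono _ fun y hy => ne_of_gt hy)
  have h2 : ∀ᶠ y in 𝓝[>] x, y ∈ s := nhdsWithin_le_nhds (hs.mem_nhds hxs)
  have h3 : ∀ᶠ y in 𝓝[>] x, 0 < deriv v y ∧ y ∈ s := by
    filter_upwards [h1, h2, self_mem_nhdsWithin] with y hy hys hxy
    refine ⟨?_, hys⟩
    rw [slope_def_field, div_pos_iff_of_pos_right (sub_pos.2 hxy)] at hy
    exact pos_of_mul_pos_right (by nlinarith : 0 < y * deriv v y) (hx.trans hxy).le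
  obtain ⟨z, hz, hzs⟩ := (mem_nhdsGT_iff_exists_Ioo_subset).1 h3
  filter_upwards [Ioo_mem_nhdsGT hz] with y hy
  have hsub : Icc x y ⊆ s := by
    intro w hw
    rcases hw.1.eq_or_lt with rfl | h
    · exact hxs
    · exact (hzs ⟨h, hw.2.trans_lt hy.2⟩).2
  refine strictMonoOn_of_deriv_pos (convex_Icc x y) (hv.continuousOn.mono hsub) ?_
    (left_mem_Icc.2 hy.1.le) (right_mem_Icc.2 hy.1.le) hy.1
  intro w hw
  rw [interior_Icc] at hw
  exact (hzs ⟨hw.1, hw.2.trans hy.2⟩).1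

namespace ProfileSolution

variable {a2 b2 c2 : ℝ} {k : ℤ} {R : ℝ≥0∞} {u v : ℝ → ℝ}

theorem hasDerivAt_u (h : ProfileSolution a2 b2 c2 k R u v) {r : ℝ} (hr : r ∈ Iset R) :
    HasDerivAt u (deriv u r) r :=
  ((h.smooth_u.differentiableOn (by norm_num)).differentiableAt
    ((isOpen_Iset R).mem_nhds hr)).hasDerivAt

theorem hasDerivAt_v (h : ProfileSolution a2 b2 c2 k R u v) {r : ℝ} (hr : r ∈ Iset R) :
    HasDerivAt v (deriv v r) r :=
  ((h.smooth_v.differentiableOn (by norm_num)).differentiableAt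
    ((isOpen_Iset R).mem_nhds hr)).hasDerivAt

theorem contDiffOn_deriv_u (h : ProfileSolution a2 b2 c2 k R u v) :
    ContDiffOn ℝ 1 (deriv u) (Iset R) :=
  h.smooth_u.deriv_of_isOpen (isOpen_Iset R) (by norm_num)

theorem contDiffOn_deriv_v (h : ProfileSolution a2 b2 c2 k R u v) :
    ContDiffOn ℝ 1 (deriv v) (Iset R) :=
  h.smooth_v.deriv_of_isOpen (isOpen_Iset R) (by norm_num)

theorem hasDerivAt_mul_deriv_u (h : ProfileSolution a2 b2 c2 k R u v) {r : ℝ}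
    (hr : r ∈ Iset R) :
    HasDerivAt (fun r => r * deriv u r)
      (r * ((k : ℝ) ^ 2 / r ^ 2 * u r + hfun a2 b2 c2 (u r) (v r))) r := by
  have h1 := ((h.contDiffOn_deriv_u.differentiableOn (by norm_num)).differentiableAt
    ((isOpen_Iset R).mem_nhds hr)).hasDerivAt
  refine ((hasDerivAt_id r).mul h1).congr_deriv ?_
  rw [← h.ode_u r hr]
  have := hr.1.ne'
  simp only [id]
  field_simp
  ring

theorem hasDerivAt_mul_deriv_v (h : ProfileSolution a2 b2 c2 k R u v) {r : ℝ}
    (hr : r ∈ Iset R) :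
    HasDerivAt (fun r => r * deriv v r) (r * gfun a2 b2 c2 (u r) (v r)) r := by
  have h1 := ((h.contDiffOn_deriv_v.differentiableOn (by norm_num)).differentiableAt
    ((isOpen_Iset R).mem_nhds hr)).hasDerivAt
  refine ((hasDerivAt_id r).mul h1).congr_deriv ?_
  rw [← h.ode_v r hr]
  have := hr.1.ne'
  simp only [id]
  field_simp
  ring

theorem deriv_v_neg_of_gt (h : ProfileSolution a2 b2 c2 k R u v) (hc : 0 < c2)
    (hle : b2 ^ 2 ≤ 3 * a2 * c2) (hv : ∀ r ∈ Iset R, v r < 0) {r : ℝ} (hr : r ∈ Iset R)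
    (hvr : -(b2 / √6 / c2) < v r) : deriv v r < 0 := by
  by_contra! hd
  have hlim : ∀ᶠ y in endFilter R, v y < v r :=
    h.bcR_v.eventually (gt_mem_nhds ((neg_sPlus_div_le hc hle).trans_lt hvr))
  have := endFilter_neBot (R := R)
  obtain ⟨s, hs, hrs, hsI⟩ := (hlim.and (eventually_endFilter hr)).exists
  have hsub := Icc_subset_Iset hr hsI
  obtain ⟨x, hx, hmax⟩ := isCompact_Icc.exists_isMaxOn (nonempty_Icc.2 hrs.le)
    (h.smooth_v.continuousOn.mono hsub)
  have hrx : v r ≤ v x := hmax (left_mem_Icc.2 hrs.le)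
  have hxs : x < s := hx.2.lt_of_ne (by rintro rfl; linarith)
  have hdx : 0 ≤ deriv v x := by
    rcases hx.1.eq_or_lt with rfl | hlt
    · exact hd
    · exact (hmax.isLocalMax (Icc_mem_nhds hlt hxs)).deriv_eq_zero.ge
  have hxI := hsub hx
  have hev := eventually_right_lt_of_deriv_nonneg (isOpen_Iset R) hxI hxI.1
    (h.smooth_v.differentiableOn (by norm_num)) hdx (h.hasDerivAt_mul_deriv_v hxI)
    (mul_pos hxI.1 (gfun_pos hc hle (hvr.trans_le hrx) (hv x hxI)))
  obtain ⟨y, hy, hyx⟩ := (hev.and (Ioo_mem_nhdsGT hxs)).exists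
  exact absurd (hmax (⟨hx.1.trans hyx.1.le, hyx.2.le⟩ : y ∈ Icc r s)) (not_le.2 hy)

/-- For `b⁴ ≤ 3a²c²`, a profile solution with `v < 0` satisfies `v ≤ -b²/(√6 c²)`. -/
theorem v_le (h : ProfileSolution a2 b2 c2 k R u v) (hc : 0 < c2)
    (hle : b2 ^ 2 ≤ 3 * a2 * c2) (hv : ∀ r ∈ Iset R, v r < 0) {r : ℝ} (hr : r ∈ Iset R) :
    v r ≤ -(b2 / √6 / c2) := by
  by_contra! hvr
  have hge : ∀ s, 0 < s → s ≤ r → v r ≤ v s := by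
    intro s hs hsr
    have hsI := mem_Iset_of_le hs hsr hr
    have hsub := Icc_subset_Iset hsI hr
    obtain ⟨x, hx, hmax⟩ := isCompact_Icc.exists_isMaxOn (nonempty_Icc.2 hsr)
      (h.smooth_v.continuousOn.mono hsub)
    have hrx : v r ≤ v x := hmax (right_mem_Icc.2 hsr)
    rcases hx.1.eq_or_lt with rfl | hlt
    · exact hrx
    have hneg := h.deriv_v_neg_of_gt hc hle hv (hsub hx) (hvr.trans_le hrx)
    have hslope := (hasDerivAt_iff_tendsto_slope.1 (h.hasDerivAt_v (hsub hx))).eventually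
      (gt_mem_nhds hneg)
    have hev : ∀ᶠ y in 𝓝[<] x, slope v x y < 0 :=
      hslope.filter_mono (nhdsWithin_mono _ fun y hy => ne_of_lt hy)
    obtain ⟨y, hy, hyx⟩ := (hev.and (Ioo_mem_nhdsLT hlt)).exists
    have hle' : v y ≤ v x := hmax (⟨hyx.1.le, hyx.2.le.trans hx.2⟩ : y ∈ Icc s r)
    rw [slope_def_field] at hy
    exact absurd (div_nonneg_of_nonpos (sub_nonpos.2 hle') (sub_nonpos.2 hyx.2.le))
      (not_le.2 hy)
  have hF : ∀ s, 0 < s → s ≤ r → s * deriv v s ≤ r * deriv v r := by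
    intro s hs hsr
    have hsub := Icc_subset_Iset (mem_Iset_of_le hs hsr hr) hr
    refine monotoneOn_of_deriv_nonneg (f := fun t => t * deriv v t) (convex_Icc s r)
      (fun t ht => (h.hasDerivAt_mul_deriv_v (hsub ht)).continuousAt.continuousWithinAt)
      (fun t ht => (h.hasDerivAt_mul_deriv_v
        (hsub (interior_subset ht))).differentiableAt.differentiableWithinAt)
      (fun t ht => ?_) (left_mem_Icc.2 hsr) (right_mem_Icc.2 hsr) hsr
    have htI := interior_subset ht
    rw [(h.hasDerivAt_mul_deriv_v (hsub htI)).deriv]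
    exact (mul_pos (hsub htI).1 (gfun_pos hc hle
      (hvr.trans_le (hge t (hsub htI).1 htI.2)) (hv t (hsub htI)))).le
  have hneg := mul_neg_of_pos_of_neg hr.1 (h.deriv_v_neg_of_gt hc hle hv hr hvr)
  have hlim : Tendsto (fun s => s * deriv v s) (𝓝[>] 0) (𝓝 (0 * 0)) :=
    (tendsto_nhdsWithin_of_tendsto_nhds tendsto_id).mul h.bc0_v
  refine absurd (le_of_tendsto hlim ?_) (by simpa using hneg)
  filter_upwards [Ioo_mem_nhdsGT hr.1] with s hs
  exact hF s hs.1 hs.2.le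

end ProfileSolution

/-- The zeroth-order part of the second variation left after the Hardy decomposition
is positive definite. -/
theorem residual_form_pos {β c2 u v x y : ℝ} (hβ : 0 < β) (hc : 0 < c2) (hu : 0 < u)
    (hv : v ≤ -(β / c2)) (hxy : x ≠ 0 ∨ y ≠ 0) :
    0 < 2 * c2 * u ^ 2 * x ^ 2 + 4 * u * x * y * (β + c2 * v)
      + (-β * v + 2 * c2 * v ^ 2 - β * u ^ 2 / v) * y ^ 2 := by
  have hv0 : v < 0 := hv.trans_lt (by simp only [neg_lt_zero]; positivity)
  have hcv : β ≤ c2 * -v := by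
    rw [mul_comm, ← div_le_iff₀ hc]; linarith
  have hw : 0 < -(β * u ^ 2 / v) := neg_pos.2 (div_neg_of_pos_of_neg (by positivity) hv0)
  have key : 0 < c2 * (2 * c2 * u ^ 2 * x ^ 2 + 4 * u * x * y * (β + c2 * v)
      + (-β * v + 2 * c2 * v ^ 2 - β * u ^ 2 / v) * y ^ 2) := by
    have e : c2 * (2 * c2 * u ^ 2 * x ^ 2 + 4 * u * x * y * (β + c2 * v)
        + (-β * v + 2 * c2 * v ^ 2 - β * u ^ 2 / v) * y ^ 2)
        = 2 * (c2 * u * x + (β + c2 * v) * y) ^ 2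
          + (β * (5 * (c2 * -v) - 2 * β) + c2 * -(β * u ^ 2 / v)) * y ^ 2 := by ring
    rw [e]
    have hD : 0 < β * (5 * (c2 * -v) - 2 * β) + c2 * -(β * u ^ 2 / v) :=
      add_pos (mul_pos hβ (by linarith)) (mul_pos hc hw)
    rcases eq_or_ne y 0 with rfl | hy
    · have hx : x ≠ 0 := by simpa using hxy
      have : 0 < (c2 * u * x) ^ 2 := by positivity
      simpa using this
    · have : 0 < y ^ 2 := by positivity
      have := mul_pos hD this
      positivity
  exact pos_of_mul_pos_right key hc.le

theorem hasDerivAt_mul_sq_div {p f w : ℝ → ℝ} {p' f' w' r : ℝ} (hp : HasDerivAt p p' r)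
    (hf : HasDerivAt f f' r) (hw : HasDerivAt w w' r) (hw0 : w r ≠ 0) :
    HasDerivAt (fun t => p t * f t ^ 2 / w t)
      (p' * f r ^ 2 / w r + p r * (2 * f r * f' / w r - f r ^ 2 * w' / w r ^ 2)) r := by
  refine ((hp.mul (hf.pow 2)).div hw hw0).congr_deriv ?_
  simp only [Pi.mul_apply, Pi.pow_apply]
  field_simp
  ring

theorem exists_Icc_subset_Iset {R : ℝ≥0∞} {K : Set ℝ} (hK : IsCompact K) (hne : K.Nonempty)
    (hKI : K ⊆ Iset R) : ∃ α β, α < β ∧ K ⊆ Ioo α β ∧ Icc α β ⊆ Iset R := by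
  obtain ⟨s, hs, hsmin⟩ := hK.exists_isLeast hne
  obtain ⟨t, ht, htmax⟩ := hK.exists_isGreatest hne
  have hs0 := (hKI hs).1
  have hev : ∀ᶠ y in 𝓝[>] t, y ∈ Iset R :=
    nhdsWithin_le_nhds ((isOpen_Iset R).mem_nhds (hKI ht))
  obtain ⟨β, hβ, htβ⟩ := (hev.and self_mem_nhdsWithin).exists
  have hα : s / 2 < s := by linarith
  have hst : s ≤ t := hsmin ht
  have htβ' : t < β := htβ
  refine ⟨s / 2, β, by linarith, fun x hx => ⟨hα.trans_le (hsmin hx),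
    (htmax hx).trans_lt htβ'⟩, Icc_subset_Iset (mem_Iset_of_le (by linarith) hα.le (hKI hs)) hβ⟩

/-- **Strict stability of the radial profile for `b⁴ ≤ 3a²c²`**: for any profile solution
with `u > 0`, `v < 0`, the second variation `B(ξ,η)` is strictly positive for every pair of
C¹ functions with compact support in `(0,R)`, not both identically zero. -/
theorem stmt4 (a2 b2 c2 : ℝ) (ha : 0 < a2) (hb : 0 < b2) (hc : 0 < c2)
    (hle : b2 ^ 2 ≤ 3 * a2 * c2) (k : ℤ) (hk : k ≠ 0) (R : ℝ≥0∞) (hR : 0 < R)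
    (u v : ℝ → ℝ) (hsol : ProfileSolution a2 b2 c2 k R u v)
    (hu : ∀ r ∈ Iset R, 0 < u r) (hv : ∀ r ∈ Iset R, v r < 0)
    (ξ η : ℝ → ℝ) (hξ : ContDiff ℝ 1 ξ) (hη : ContDiff ℝ 1 η)
    (hξc : HasCompactSupport ξ) (hηc : HasCompactSupport η)
    (hξs : tsupport ξ ⊆ Iset R) (hηs : tsupport η ⊆ Iset R)
    (hne : ¬(ξ = 0 ∧ η = 0)) :
    0 < Bform a2 b2 c2 k R u v ξ η := by
  set β : ℝ := b2 / √6 with hβ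
  have hβ0 : 0 < β := by positivity
  have hvle : ∀ r ∈ Iset R, v r ≤ -(β / c2) := fun r hr => hsol.v_le hc hle hv hr
  have hzero : ∀ r, r ∉ tsupport ξ ∪ tsupport η →
      ξ r = 0 ∧ η r = 0 ∧ deriv ξ r = 0 ∧ deriv η r = 0 := by
    intro r hr
    simp only [mem_union, not_or] at hr
    exact ⟨image_eq_zero_of_notMem_tsupport hr.1, image_eq_zero_of_notMem_tsupport hr.2,
      image_eq_zero_of_notMem_tsupport fun h => hr.1 (tsupport_deriv_subset (f := ξ) h),
      image_eq_zero_of_notMem_tsupport fun h => hr.2 (tsupport_deriv_subset (f := η) h)⟩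
  obtain ⟨r₀, hr₀⟩ : ∃ r, ξ r ≠ 0 ∨ η r ≠ 0 := by
    by_contra! h
    exact hne ⟨funext fun r => (h r).1, funext fun r => (h r).2⟩
  have hr₀K : r₀ ∈ tsupport ξ ∪ tsupport η := by
    by_contra h
    have := hzero r₀ h
    tauto
  obtain ⟨x, y, hxy, hKxy, hI⟩ := exists_Icc_subset_Iset
    (IsCompact.union hξc hηc) ⟨r₀, hr₀K⟩ (union_subset hξs hηs)
  have hout : ∀ r, r ∉ Ioo x y → ξ r = 0 ∧ η r = 0 ∧ deriv ξ r = 0 ∧ deriv η r = 0 :=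
    fun r hr => hzero r fun h => hr (hKxy h)
  have hcξ := hξ.continuous
  have hcη := hη.continuous
  have hcdξ := hξ.continuous_deriv (by norm_num)
  have hcdη := hη.continuous_deriv (by norm_num)
  have hcu := hsol.smooth_u.continuousOn.mono hI
  have hcv := hsol.smooth_v.continuousOn.mono hI
  have hcdu := hsol.contDiffOn_deriv_u.continuousOn.mono hI
  have hcdv := hsol.contDiffOn_deriv_v.continuousOn.mono hI
  have hr0 : ∀ r ∈ Icc x y, r ≠ 0 := fun r hr => (hI hr).1.ne'
  have hu0 : ∀ r ∈ Icc x y, u r ≠ 0 := fun r hr => (hu r (hI hr)).ne'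
  have hv0 : ∀ r ∈ Icc x y, v r ≠ 0 := fun r hr => (hv r (hI hr)).ne
  unfold Bform
  set f : ℝ → ℝ := fun r => (deriv ξ r ^ 2 + (k : ℝ) ^ 2 / r ^ 2 * ξ r ^ 2 + deriv η r ^ 2
      + (-a2 + 2 * b2 / Real.sqrt 6 * v r + c2 * (3 * u r ^ 2 + v r ^ 2)) * ξ r ^ 2
      + (-a2 - 2 * b2 / Real.sqrt 6 * v r + c2 * (u r ^ 2 + 3 * v r ^ 2)) * η r ^ 2
      + 4 * u r * ξ r * η r * (β + c2 * v r)) * r with hf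
  set P : ℝ → ℝ := fun r => ((deriv ξ r - deriv u r / u r * ξ r) ^ 2
      + (deriv η r - deriv v r / v r * η r) ^ 2
      + (2 * c2 * u r ^ 2 * ξ r ^ 2 + 4 * u r * ξ r * η r * (β + c2 * v r)
        + (-β * v r + 2 * c2 * v r ^ 2 - β * u r ^ 2 / v r) * η r ^ 2)) * r with hP
  have hcf : ContinuousOn f (Icc x y) := by
    have : ∀ r ∈ Icc x y, r ^ 2 ≠ 0 := fun r hr => pow_ne_zero 2 (hr0 r hr)
    fun_prop (disch := assumption)
  have hcP : ContinuousOn P (Icc x y) := by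
    fun_prop (disch := assumption)
  have hPpos : ∀ r ∈ Icc x y, ξ r ≠ 0 ∨ η r ≠ 0 → 0 < P r := fun r hr h => by
    have := residual_form_pos hβ0 hc (hu r (hI hr)) (hvle r (hI hr)) h
    exact mul_pos (by positivity) (hI hr).1
  have hPnonneg : ∀ r ∈ Icc x y, 0 ≤ P r := fun r hr => by
    by_cases h : ξ r ≠ 0 ∨ η r ≠ 0
    · exact (hPpos r hr h).le
    · push Not at h
      have := (hI hr).1
      simp only [hP, h.1, h.2]
      have e : (deriv ξ r - deriv u r / u r * 0) ^ 2 + (deriv η r - deriv v r / v r * 0) ^ 2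
        + (2 * c2 * u r ^ 2 * 0 ^ 2 + 4 * u r * 0 * 0 * (β + c2 * v r)
        + (-β * v r + 2 * c2 * v r ^ 2 - β * u r ^ 2 / v r) * 0 ^ 2)
          = deriv ξ r ^ 2 + deriv η r ^ 2 := by ring
      rw [e]
      positivity
  have hW : ∀ r ∈ uIcc x y, HasDerivAt
      (fun t => t * deriv u t * ξ t ^ 2 / u t + t * deriv v t * η t ^ 2 / v t)
      (f r - P r) r := by
    intro r hr
    rw [uIcc_of_le hxy.le] at hr
    have hrI := hI hr
    have h1 := hasDerivAt_mul_sq_div (hsol.hasDerivAt_mul_deriv_u hrI)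
      (hξ.differentiable (by norm_num) r).hasDerivAt (hsol.hasDerivAt_u hrI) (hu0 r hr)
    have h2 := hasDerivAt_mul_sq_div (hsol.hasDerivAt_mul_deriv_v hrI)
      (hη.differentiable (by norm_num) r).hasDerivAt (hsol.hasDerivAt_v hrI) (hv0 r hr)
    refine (h1.add h2).congr_deriv ?_
    have e : 2 * b2 / √6 = 2 * β := by rw [hβ]; ring
    simp only [hf, hP, hfun, gfun, e, ← hβ]
    have := hr0 r hr
    have := hu0 r hr
    have := hv0 r hr
    clear_value β
    field_simp
    ring
  have hcongr : ∫ r in Iset R, f r = ∫ r in x..y, f r := by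
    rw [intervalIntegral.integral_of_le hxy.le]
    refine setIntegral_eq_of_subset_of_forall_sdiff_eq_zero (isOpen_Iset R).measurableSet
      (Ioc_subset_Icc_self.trans hI) fun r hr => ?_
    obtain ⟨h1, h2, h3, h4⟩ := hout r fun h => hr.2 (Ioo_subset_Ioc_self h)
    simp [hf, h1, h2, h3, h4]
  have hif : IntervalIntegrable f volume x y := hcf.intervalIntegrable_of_Icc hxy.le
  have hiP : IntervalIntegrable P volume x y := hcP.intervalIntegrable_of_Icc hxy.le
  have hftc := intervalIntegral.integral_eq_sub_of_hasDerivAt hW (hif.sub hiP)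
  obtain ⟨hx1, hx2, -, -⟩ := hout x (by simp)
  obtain ⟨hy1, hy2, -, -⟩ := hout y (by simp)
  rw [intervalIntegral.integral_sub hif hiP] at hftc
  simp only [hx1, hx2, hy1, hy2] at hftc
  have hpos : 0 < ∫ r in x..y, P r :=
    intervalIntegral.integral_pos hxy hcP (fun r hr => hPnonneg r (Ioc_subset_Icc_self hr))
      ⟨r₀, Ioo_subset_Icc_self (hKxy hr₀K), hPpos r₀ (Ioo_subset_Icc_self (hKxy hr₀K)) hr₀⟩
  rw [hcongr]
  norm_num at hftc
  linarith

end
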